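/- Suppose (z₁,z₂) is a critical point of the functional 𝓑(z₁,z₂) := 2‖z₁‖²‖z₁'‖² + 2/‖z₁‖² + 2‖z₂‖²‖z₂'‖² + 2/‖z₂‖² − (‖z₁‖²‖z₂‖²)/(‖z₁²‖²‖z₂‖² + ‖z₂²‖²‖z₁‖²) on the open subset of H¹(S¹,ℝ²) where ‖z₁‖ > 0 and ‖z₂‖ > 0. Then z₁ and z₂ are smooth and satisfy the uncoupled ODEs z_i'' = a_i·z_i + b_i·z_i³, where a_i = ‖z_i'‖²/‖z_i‖² − 1/‖z_i‖⁶ − (‖z_j‖⁴‖z_i²‖²)/(2‖z_i‖²·(‖z₁²‖²‖z₂‖² + ‖z₂²‖²‖z₁‖²)²) and b_i = ‖z_j‖⁴/(‖z₁²‖²‖z₂‖² + ‖z₂²‖²‖z₁‖²)² with {i,j} = {1,2}. -/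

import Mathlib

open Set Real MeasureTheory

/-- L² norm squared ‖z‖² = ∫₀¹ z² of a loop. -/
noncomputable def nsq (z : ℝ → ℝ) : ℝ := ∫ τ in Set.Ioo (0:ℝ) 1, (z τ) ^ 2

/-- ‖z²‖² = ∫₀¹ z⁴. -/
noncomputable def nsq4 (z : ℝ → ℝ) : ℝ := ∫ τ in Set.Ioo (0:ℝ) 1, (z τ) ^ 4

/-- ‖z'‖² = ∫₀¹ (z')². -/
noncomputable def nsqd (z : ℝ → ℝ) : ℝ := ∫ τ in Set.Ioo (0:ℝ) 1, (deriv z τ) ^ 2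

/-- The mean-interaction action functional
𝓑(z₁,z₂) = 2‖z₁‖²‖z₁'‖² + 2/‖z₁‖² + 2‖z₂‖²‖z₂'‖² + 2/‖z₂‖²
            − ‖z₁‖²‖z₂‖²/(‖z₁²‖²‖z₂‖² + ‖z₂²‖²‖z₁‖²). -/
noncomputable def Bav (z₁ z₂ : ℝ → ℝ) : ℝ :=
  2 * nsq z₁ * nsqd z₁ + 2 / nsq z₁ + 2 * nsq z₂ * nsqd z₂ + 2 / nsq z₂
    - nsq z₁ * nsq z₂ / (nsq4 z₁ * nsq z₂ + nsq4 z₂ * nsq z₁)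

/-- A set integral over `Ioo 0 1` as an interval integral. -/
lemma setIntegral_Ioo_zero_one_eq (f : ℝ → ℝ) :
    ∫ τ in Set.Ioo (0:ℝ) 1, f τ = ∫ τ in (0:ℝ)..1, f τ := by
  rw [intervalIntegral.integral_of_le zero_le_one, integral_Ioc_eq_integral_Ioo]

lemma continuous_primitive_hasDerivAt {g : ℝ → ℝ} (hg : Continuous g) (t : ℝ) :
    HasDerivAt (fun t => ∫ s in (0:ℝ)..t, g s) (g t) t :=
  intervalIntegral.integral_hasDerivAt_right (hg.intervalIntegrable _ _)
    (hg.stronglyMeasurableAtFilter _ _) hg.continuousAt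

/-- The primitive of a periodic function of mean zero is periodic. -/
lemma periodic_primitive {g : ℝ → ℝ} (hg : Continuous g) (hp : Function.Periodic g 1)
    (h0 : ∫ s in (0:ℝ)..1, g s = 0) :
    Function.Periodic (fun t => ∫ s in (0:ℝ)..t, g s) 1 := by
  intro t
  have h1 := hp.intervalIntegral_add_eq t 0
  rw [zero_add, h0] at h1
  have h2 := intervalIntegral.integral_add_adjacent_intervals
    (hg.intervalIntegrable (μ := volume) 0 t) (hg.intervalIntegrable t (t + 1))
  simp only
  linarith

lemma contDiff_one_of_hasDerivAt {f g : ℝ → ℝ} (hg : Continuous g)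
    (h : ∀ t, HasDerivAt f (g t) t) : ContDiff ℝ 1 f := by
  have hd : deriv f = g := funext fun t => (h t).deriv
  exact contDiff_one_iff_deriv.2 ⟨fun t => (h t).differentiableAt, hd ▸ hg⟩

/-- A periodic continuous function with vanishing integral of its square over a period
vanishes. -/
lemma eq_zero_of_integral_sq_eq_zero {k : ℝ → ℝ} (hk : Continuous k)
    (hp : Function.Periodic k 1) (h0 : ∫ s in (0:ℝ)..1, k s ^ 2 = 0) (t : ℝ) : k t = 0 := by
  obtain ⟨y, hy, hty⟩ := hp.exists_mem_Ico₀ one_pos t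
  rw [hty]
  by_contra hne
  have hpos : 0 < ∫ s in (0:ℝ)..1, k s ^ 2 :=
    intervalIntegral.integral_pos zero_lt_one (by fun_prop) (fun x _ => sq_nonneg _)
      ⟨y, ⟨hy.1, hy.2.le⟩, by positivity⟩
  exact hpos.ne' h0

/-- Du Bois-Reymond lemma on the circle. -/
lemma hasDerivAt_of_weak {f g : ℝ → ℝ} (hf : Continuous f) (hg : Continuous g)
    (hpf : Function.Periodic f 1) (hpg : Function.Periodic g 1)
    (h : ∀ v : ℝ → ℝ, ContDiff ℝ 1 v → Function.Periodic v 1 →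
      (∫ s in (0:ℝ)..1, f s * deriv v s) + ∫ s in (0:ℝ)..1, g s * v s = 0) (t : ℝ) :
    HasDerivAt f (g t) t := by
  have hg0 : ∫ s in (0:ℝ)..1, g s = 0 := by
    simpa using h (fun _ => 1) contDiff_const (fun _ => rfl)
  set G : ℝ → ℝ := fun t => ∫ s in (0:ℝ)..t, g s with hG
  have hGd : ∀ t, HasDerivAt G (g t) t := continuous_primitive_hasDerivAt hg
  have hGp : Function.Periodic G 1 := periodic_primitive hg hpg hg0
  have hGc : Continuous G := continuous_iff_continuousAt.2 fun t => (hGd t).continuousAt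
  set c : ℝ := ∫ s in (0:ℝ)..1, (f s - G s) with hc
  set k : ℝ → ℝ := fun s => f s - G s - c with hk
  have hkc : Continuous k := by fun_prop
  have hkp : Function.Periodic k 1 := fun s => by simp only [hk, hpf s, hGp s]
  have hk0 : ∫ s in (0:ℝ)..1, k s = 0 := by
    simp only [hk]
    rw [intervalIntegral.integral_sub (Continuous.intervalIntegrable (by fun_prop) _ _) (by simp)]
    simp [hc]
  set v : ℝ → ℝ := fun t => ∫ s in (0:ℝ)..t, k s with hv
  have hvd : ∀ t, HasDerivAt v (k t) t := continuous_primitive_hasDerivAt hkc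
  have hvp : Function.Periodic v 1 := periodic_primitive hkc hkp hk0
  have hvc : Continuous v := continuous_iff_continuousAt.2 fun t => (hvd t).continuousAt
  have hw := h v (contDiff_one_of_hasDerivAt hkc hvd) hvp
  have hdv : deriv v = k := funext fun t => (hvd t).deriv
  rw [hdv] at hw
  have hparts : ∫ s in (0:ℝ)..1, (g s * v s + G s * k s) = 0 := by
    rw [intervalIntegral.integral_eq_sub_of_hasDerivAt (f := fun s => G s * v s)
      (fun s _ => (hGd s).mul (hvd s)) (Continuous.intervalIntegrable (by fun_prop) _ _)]
    have h1 : v 1 = 0 := hk0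
    have h2 : v 0 = 0 := by simp [hv]
    simp [h1, h2]
  rw [intervalIntegral.integral_add (Continuous.intervalIntegrable (by fun_prop) _ _)
    (Continuous.intervalIntegrable (by fun_prop) _ _)] at hparts
  have hsq : ∫ s in (0:ℝ)..1, k s ^ 2 = 0 := by
    have e : (fun s => k s ^ 2) = fun s => f s * k s - G s * k s - c * k s := by
      funext s; simp only [hk]; ring
    rw [e, intervalIntegral.integral_sub (Continuous.intervalIntegrable (by fun_prop) _ _)
      (Continuous.intervalIntegrable (by fun_prop) _ _),
      intervalIntegral.integral_sub (Continuous.intervalIntegrable (by fun_prop) _ _)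
      (Continuous.intervalIntegrable (by fun_prop) _ _),
      intervalIntegral.integral_const_mul, hk0]
    linarith
  have hfG : f = fun s => G s + c := by
    funext s
    have := eq_zero_of_integral_sq_eq_zero hkc hkp hsq s
    simp only [hk] at this
    linarith
  rw [hfG]
  exact (hGd t).add_const c

/-- Differentiation under the integral sign along the line `z + ε v` for a power of a
continuous function. -/
lemma hasDerivAt_integral_add_mul_pow {z v : ℝ → ℝ} (hz : Continuous z) (hv : Continuous v)
    (n : ℕ) :
    HasDerivAt (fun ε : ℝ => ∫ s in (0:ℝ)..1, (z s + ε * v s) ^ n)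
      (∫ s in (0:ℝ)..1, n * z s ^ (n - 1) * v s) 0 := by
  have key := (intervalIntegral.hasDerivAt_integral_of_dominated_loc_of_deriv_le (μ := volume)
    (a := 0) (b := 1) (x₀ := (0 : ℝ)) (F := fun ε s => (z s + ε * v s) ^ n)
    (F' := fun ε s => n * (z s + ε * v s) ^ (n - 1) * v s)
    (bound := fun s => n * (|z s| + |v s|) ^ (n - 1) * |v s|)
    (Metric.ball_mem_nhds 0 one_pos)
    (Filter.Eventually.of_forall fun ε => Continuous.aestronglyMeasurable (by fun_prop))
    (Continuous.intervalIntegrable (by fun_prop) _ _)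
    (Continuous.aestronglyMeasurable (by fun_prop)) ?_
    (Continuous.intervalIntegrable (by fun_prop) _ _) ?_).2
  · simpa using key
  · refine Filter.Eventually.of_forall fun s _ ε hε => ?_
    have hε1 : |ε| ≤ 1 := by simpa using (mem_ball_zero_iff.1 hε).le
    have h1 : |z s + ε * v s| ≤ |z s| + |v s| := by
      refine (abs_add_le _ _).trans ?_
      rw [abs_mul]
      gcongr
      exact mul_le_of_le_one_left (abs_nonneg _) hε1
    rw [Real.norm_eq_abs, abs_mul, abs_mul, abs_pow, Nat.abs_cast]
    gcongr
  · refine Filter.Eventually.of_forall fun s _ ε _ => ?_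
    exact (((hasDerivAt_mul_const (v s)).const_add (z s)).pow n)

lemma nsq_sq_le_nsq4 {z : ℝ → ℝ} (hz : Continuous z) : nsq z ^ 2 ≤ nsq4 z := by
  have h : 0 ≤ ∫ s in (0:ℝ)..1, (z s ^ 2 - nsq z) ^ 2 :=
    intervalIntegral.integral_nonneg zero_le_one fun _ _ => sq_nonneg _
  have e : (fun s => (z s ^ 2 - nsq z) ^ 2)
      = fun s => z s ^ 4 - 2 * nsq z * z s ^ 2 + nsq z ^ 2 := by funext s; ring
  rw [e, intervalIntegral.integral_add (Continuous.intervalIntegrable (by fun_prop) _ _)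
    (by simp), intervalIntegral.integral_sub (Continuous.intervalIntegrable (by fun_prop) _ _)
    (Continuous.intervalIntegrable (by fun_prop) _ _), intervalIntegral.integral_const_mul,
    ← setIntegral_Ioo_zero_one_eq, ← setIntegral_Ioo_zero_one_eq] at h
  change 0 ≤ nsq4 z - 2 * nsq z * nsq z + _ at h
  simp at h
  linarith

lemma hasDerivAt_nsq {z v : ℝ → ℝ} (hz : Continuous z) (hv : Continuous v) :
    HasDerivAt (fun ε : ℝ => nsq fun τ => z τ + ε * v τ) (2 * ∫ s in (0:ℝ)..1, z s * v s) 0 := by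
  simpa [nsq, setIntegral_Ioo_zero_one_eq, mul_assoc] using
    hasDerivAt_integral_add_mul_pow hz hv 2

lemma hasDerivAt_nsq4 {z v : ℝ → ℝ} (hz : Continuous z) (hv : Continuous v) :
    HasDerivAt (fun ε : ℝ => nsq4 fun τ => z τ + ε * v τ)
      (4 * ∫ s in (0:ℝ)..1, z s ^ 3 * v s) 0 := by
  simpa [nsq4, setIntegral_Ioo_zero_one_eq, mul_assoc] using
    hasDerivAt_integral_add_mul_pow hz hv 4

lemma hasDerivAt_nsqd {z v : ℝ → ℝ} (hz : ContDiff ℝ 1 z) (hv : ContDiff ℝ 1 v) :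
    HasDerivAt (fun ε : ℝ => nsqd fun τ => z τ + ε * v τ)
      (2 * ∫ s in (0:ℝ)..1, deriv z s * deriv v s) 0 := by
  have e (ε s : ℝ) : deriv (fun τ => z τ + ε * v τ) s = deriv z s + ε * deriv v s :=
    ((hz.differentiable one_ne_zero s).hasDerivAt.add
      ((hv.differentiable one_ne_zero s).hasDerivAt.const_mul ε)).deriv
  simpa [nsqd, setIntegral_Ioo_zero_one_eq, mul_assoc, e] using
    hasDerivAt_integral_add_mul_pow hz.continuous_deriv_one hv.continuous_deriv_one 2

lemma Bav_comm (z w : ℝ → ℝ) : Bav z w = Bav w z := by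
  simp only [Bav, add_comm (nsq4 z * nsq w), mul_comm (nsq z) (nsq w)]
  ring

/-- A `C¹` solution of `z'' = a z + b z³` is smooth. -/
lemma contDiff_of_cubic_ode {z : ℝ → ℝ} {a b : ℝ} (hz : ContDiff ℝ 1 z)
    (h : ∀ t, HasDerivAt (deriv z) (a * z t + b * z t ^ 3) t) : ContDiff ℝ (⊤ : ℕ∞) z := by
  have hd : deriv (deriv z) = fun t => a * z t + b * z t ^ 3 := funext fun t => (h t).deriv
  refine contDiff_infty.2 fun n => ?_
  induction n with
  | zero => exact hz.of_le (by simp)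
  | succ n ih =>
    have h1 : ContDiff ℝ (n + 1) (deriv z) := by
      refine contDiff_succ_iff_deriv.2 ⟨fun t => (h t).differentiableAt, by simp, ?_⟩
      rw [hd]
      fun_prop
    push_cast
    exact contDiff_succ_iff_deriv.2
      ⟨hz.differentiable one_ne_zero, by simp, h1.of_le le_self_add⟩

/-- Criticality of `Bav` in its first argument gives the Euler-Lagrange equation. -/
lemma hasDerivAt_deriv_of_critical {z w : ℝ → ℝ} (hz : ContDiff ℝ 1 z) (hw : Continuous w)
    (hper : Function.Periodic z 1) (hn : 0 < nsq z) (hnw : 0 < nsq w)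
    (hcrit : ∀ v : ℝ → ℝ, ContDiff ℝ 1 v → Function.Periodic v 1 →
      HasDerivAt (fun ε : ℝ => Bav (fun τ => z τ + ε * v τ) w) 0 0) (τ : ℝ) :
    HasDerivAt (deriv z)
      ((nsqd z / nsq z - 1 / (nsq z) ^ 3 -
        (nsq w) ^ 2 * nsq4 z /
          (2 * nsq z * (nsq4 z * nsq w + nsq4 w * nsq z) ^ 2)) * z τ +
      ((nsq w) ^ 2 / (nsq4 z * nsq w + nsq4 w * nsq z) ^ 2) * (z τ) ^ 3) τ := by
  have hzc := hz.continuous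
  have hP : 0 < nsq4 z * nsq w + nsq4 w * nsq z := by
    have h1 := nsq_sq_le_nsq4 hzc
    have h2 := nsq_sq_le_nsq4 hw
    have h3 : 0 < nsq4 z := by nlinarith
    have h4 : 0 < nsq4 w := by nlinarith
    positivity
  have hper' : Function.Periodic (deriv z) 1 := fun s => by
    rw [← deriv_comp_add_const]
    exact congrArg (deriv · s) (funext hper)
  set a := nsqd z / nsq z - 1 / (nsq z) ^ 3 -
    (nsq w) ^ 2 * nsq4 z / (2 * nsq z * (nsq4 z * nsq w + nsq4 w * nsq z) ^ 2) with ha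
  set b := (nsq w) ^ 2 / (nsq4 z * nsq w + nsq4 w * nsq z) ^ 2 with hb
  refine hasDerivAt_of_weak (g := fun s => a * z s + b * z s ^ 3) hz.continuous_deriv_one
    (by fun_prop) hper' (fun s => by simp only [hper s]) (fun v hv hvp => ?_) τ
  have hvc := hv.continuous
  have e : (fun s => (a * z s + b * z s ^ 3) * v s)
      = fun s => a * (z s * v s) + b * (z s ^ 3 * v s) := by funext s; ring
  rw [e, intervalIntegral.integral_add (Continuous.intervalIntegrable (by fun_prop) _ _)
    (Continuous.intervalIntegrable (by fun_prop) _ _), intervalIntegral.integral_const_mul,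
    intervalIntegral.integral_const_mul]
  have hN := hasDerivAt_nsq hzc hvc
  have hQ := hasDerivAt_nsq4 hzc hvc
  have hD := hasDerivAt_nsqd hz hv
  have hz0 : (fun τ => z τ + 0 * v τ) = z := by simp
  have hN0 : nsq (fun τ => z τ + 0 * v τ) ≠ 0 := by rw [hz0]; exact hn.ne'
  have hP0 : nsq4 (fun τ => z τ + 0 * v τ) * nsq w + nsq4 w * nsq (fun τ => z τ + 0 * v τ) ≠ 0 := by
    rw [hz0]; exact hP.ne'
  have hB := (((((hN.const_mul 2).mul hD).add ((hasDerivAt_const (0:ℝ) (2:ℝ)).div hN hN0)).add_const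
    (2 * nsq w * nsqd w)).add_const (2 / nsq w)).sub
    ((hN.mul_const (nsq w)).div ((hQ.mul_const (nsq w)).add (hN.const_mul (nsq4 w))) hP0)
  have huniq := hB.unique (hcrit v hv hvp)
  simp only [Pi.add_apply, hz0] at huniq
  generalize (∫ s in (0:ℝ)..1, z s * v s) = I at *
  generalize (∫ s in (0:ℝ)..1, z s ^ 3 * v s) = J at *
  generalize (∫ s in (0:ℝ)..1, deriv z s * deriv v s) = K at *
  rw [ha, hb]
  have hPne := hP.ne'
  have hnne := hn.ne'
  refine (mul_right_injective₀ (mul_ne_zero four_ne_zero hnne)) ?_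
  simp only [mul_zero]
  rw [← huniq]
  field_simp
  ring

/-- A critical point (z₁,z₂) of 𝓑 (i.e. the Gateaux differential
vanishes in all C¹ loop directions (v₁,v₂)) is smooth and satisfies the
uncoupled ODEs zᵢ'' = aᵢ·zᵢ + bᵢ·zᵢ³ with the stated constants. -/
theorem critical_point_ode (z₁ z₂ : ℝ → ℝ)
    (hz₁ : ContDiff ℝ 1 z₁) (hz₂ : ContDiff ℝ 1 z₂)
    (hper₁ : Function.Periodic z₁ 1) (hper₂ : Function.Periodic z₂ 1)
    (hn₁ : 0 < nsq z₁) (hn₂ : 0 < nsq z₂)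
    (hcrit : ∀ v₁ v₂ : ℝ → ℝ, ContDiff ℝ 1 v₁ → ContDiff ℝ 1 v₂ →
      Function.Periodic v₁ 1 → Function.Periodic v₂ 1 →
      HasDerivAt (fun ε : ℝ =>
        Bav (fun τ => z₁ τ + ε * v₁ τ) (fun τ => z₂ τ + ε * v₂ τ)) 0 0) :
    ContDiff ℝ (⊤ : ℕ∞) z₁ ∧ ContDiff ℝ (⊤ : ℕ∞) z₂ ∧
    (∀ τ : ℝ, deriv (deriv z₁) τ =
      (nsqd z₁ / nsq z₁ - 1 / (nsq z₁) ^ 3 -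
        (nsq z₂) ^ 2 * nsq4 z₁ /
          (2 * nsq z₁ * (nsq4 z₁ * nsq z₂ + nsq4 z₂ * nsq z₁) ^ 2)) * z₁ τ +
      ((nsq z₂) ^ 2 / (nsq4 z₁ * nsq z₂ + nsq4 z₂ * nsq z₁) ^ 2) * (z₁ τ) ^ 3) ∧
    (∀ τ : ℝ, deriv (deriv z₂) τ =
      (nsqd z₂ / nsq z₂ - 1 / (nsq z₂) ^ 3 -
        (nsq z₁) ^ 2 * nsq4 z₂ /
          (2 * nsq z₂ * (nsq4 z₁ * nsq z₂ + nsq4 z₂ * nsq z₁) ^ 2)) * z₂ τ +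
      ((nsq z₁) ^ 2 / (nsq4 z₁ * nsq z₂ + nsq4 z₂ * nsq z₁) ^ 2) * (z₂ τ) ^ 3) := by
  have h1 := hasDerivAt_deriv_of_critical hz₁ hz₂.continuous hper₁ hn₁ hn₂ fun v hv hp => by
    simpa using hcrit v (fun _ => 0) hv contDiff_const hp (fun _ => rfl)
  have h2 := hasDerivAt_deriv_of_critical hz₂ hz₁.continuous hper₂ hn₂ hn₁ fun v hv hp => by
    simpa [Bav_comm z₁] using hcrit (fun _ => 0) v contDiff_const hv (fun _ => rfl) hp
  rw [add_comm (nsq4 z₂ * nsq z₁)] at h2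
  exact ⟨contDiff_of_cubic_ode hz₁ h1, contDiff_of_cubic_ode hz₂ h2,
    fun τ => (h1 τ).deriv, fun τ => (h2 τ).deriv⟩
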